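/- Let (L,Δ,S) be a locality with product Π : D → L, let L' be a partial group with product Π' : D' → L', and let β : L → L' be a projection of partial groups with ker(β) ⊆ Z(L). If H is a partial subgroup of L, then Hβ is a partial subgroup of L' and (D ∩ W(H))β* = D' ∩ W(Hβ); in particular, the restriction of β to a map H → Hβ is a projection of partial groups. -/

import Mathlib

/-!
Background definitions for partial groups and localities in the sense of Chermak.

A *partial group* is given by `Data`: a domain `D` of words, a (total, but only
meaningful on `D`) product `pi : List L → L`, and an inversion map, subject to the
axioms collected in `IsPartialGroup`.
-/

namespace PartialGroups

/-- The underlying data of a partial group. -/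
structure Data (L : Type*) where
  /-- The domain of the product, a set of words. -/
  D : Set (List L)
  /-- The product `Π`, meaningful on `D`. -/
  pi : List L → L
  /-- The inversion map. -/
  inv : L → L

variable {L L' L₁ L₂ L₁' L₂' : Type*}

/-- The formal inverse of a word: `(f₁,…,fₙ)⁻¹ = (fₙ⁻¹,…,f₁⁻¹)`. -/
def Data.wInv (P : Data L) (w : List L) : List L := (w.map P.inv).reverse

/-- The identity element `1 = Π(∅)`. -/
def Data.one (P : Data L) : L := P.pi []

/-- The axioms of a partial group. -/
structure IsPartialGroup (P : Data L) : Prop where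
  /-- Inversion is an involution (in particular a bijection). -/
  inv_inv : ∀ f : L, P.inv (P.inv f) = f
  /-- `L ⊆ D` (words of length one lie in the domain). -/
  singleton_mem : ∀ f : L, [f] ∈ P.D
  /-- `u ∘ v ∈ D` implies `u ∈ D`. -/
  append_left : ∀ u v : List L, u ++ v ∈ P.D → u ∈ P.D
  /-- `u ∘ v ∈ D` implies `v ∈ D`. -/
  append_right : ∀ u v : List L, u ++ v ∈ P.D → v ∈ P.D
  /-- `Π` restricts to the identity on words of length one. -/
  pi_singleton : ∀ f : L, P.pi [f] = f
  /-- `u ∘ v ∘ w ∈ D` implies `u ∘ (Π(v)) ∘ w ∈ D`. -/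
  assoc_mem : ∀ u v w : List L, u ++ v ++ w ∈ P.D → u ++ [P.pi v] ++ w ∈ P.D
  /-- `Π(u ∘ v ∘ w) = Π(u ∘ (Π(v)) ∘ w)`. -/
  assoc_pi : ∀ u v w : List L, u ++ v ++ w ∈ P.D →
    P.pi (u ++ v ++ w) = P.pi (u ++ [P.pi v] ++ w)
  /-- `w ∈ D` implies `w⁻¹ ∘ w ∈ D`. -/
  wInv_mem : ∀ w ∈ P.D, P.wInv w ++ w ∈ P.D
  /-- `Π(w⁻¹ ∘ w) = 1`. -/
  wInv_pi : ∀ w ∈ P.D, P.pi (P.wInv w ++ w) = P.one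

/-- `D(g)`: the set of `x` for which `x^g` is defined. -/
def Data.Dconj (P : Data L) (g : L) : Set L := {x | [P.inv g, x, g] ∈ P.D}

/-- Conjugation `x^g = Π(g⁻¹, x, g)`. -/
def Data.conj (P : Data L) (x g : L) : L := P.pi [P.inv g, x, g]

/-- `X^g = {x^g : x ∈ X}`. -/
def Data.conjSet (P : Data L) (X : Set L) (g : L) : Set L := (fun x => P.conj x g) '' X

/-- `W(H)`: the set of words with all entries in `H`. -/
def Wrd (H : Set L) : Set (List L) := {w | ∀ x ∈ w, x ∈ H}

/-- The centralizer `C_L(X) = {g : x ∈ D(g) and x^g = x for all x ∈ X}`. -/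
def Data.centralizer (P : Data L) (X : Set L) : Set L :=
  {g | ∀ x ∈ X, x ∈ P.Dconj g ∧ P.conj x g = x}

/-- The center `Z(L) = C_L(L)`. -/
def Data.center (P : Data L) : Set L := P.centralizer Set.univ

/-- The normalizer `N_L(X) = {g : X ⊆ D(g) and X^g = X}`. -/
def Data.normalizer (P : Data L) (X : Set L) : Set L :=
  {g | X ⊆ P.Dconj g ∧ P.conjSet X g = X}

/-- The centralizer of `X` computed inside the partial subgroup `L₀`. -/
def Data.centralizerIn (P : Data L) (L₀ X : Set L) : Set L := L₀ ∩ P.centralizer X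

/-- The center of the partial subgroup `L₀` (with its restricted partial product). -/
def Data.centerIn (P : Data L) (L₀ : Set L) : Set L := P.centralizerIn L₀ L₀

/-- The set product `XY = {Π(x,y) : x ∈ X, y ∈ Y, (x,y) ∈ D}`. -/
def Data.setMul (P : Data L) (X Y : Set L) : Set L :=
  {z | ∃ x ∈ X, ∃ y ∈ Y, [x, y] ∈ P.D ∧ P.pi [x, y] = z}

/-- `S_g = {s ∈ S ∩ D(g) : s^g ∈ S}`. -/
def Data.SOf (P : Data L) (S : Set L) (g : L) : Set L :=
  {s | s ∈ S ∧ s ∈ P.Dconj g ∧ P.conj s g ∈ S}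

/-- A partial subgroup: closed under inversion and under products of words in the domain. -/
def Data.IsPartialSubgroup (P : Data L) (H : Set L) : Prop :=
  (∀ f ∈ H, P.inv f ∈ H) ∧ ∀ w ∈ Wrd H ∩ P.D, P.pi w ∈ H

/-- A subgroup: a partial subgroup `H` with `W(H) ⊆ D`. -/
def Data.IsSubgroup (P : Data L) (H : Set L) : Prop :=
  P.IsPartialSubgroup H ∧ Wrd H ⊆ P.D

/-- A `p`-subgroup: a subgroup whose order is a power of `p`. -/
def Data.IsPSubgroup (p : ℕ) (P : Data L) (H : Set L) : Prop :=
  P.IsSubgroup H ∧ ∃ n : ℕ, H.ncard = p ^ n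

/-- A partial normal subgroup: `n^f ∈ N` for all `f ∈ L` and `n ∈ N ∩ D(f)`. -/
def Data.IsPartialNormal (P : Data L) (N : Set L) : Prop :=
  P.IsPartialSubgroup N ∧ ∀ f : L, ∀ n ∈ N, n ∈ P.Dconj f → P.conj n f ∈ N

/-- A homomorphism of partial groups: `Dβ* ⊆ D'` and `Π'(vβ*) = (Π(v))β`. -/
def IsHom (P : Data L) (P' : Data L') (β : L → L') : Prop :=
  (∀ w ∈ P.D, w.map β ∈ P'.D) ∧ ∀ w ∈ P.D, P'.pi (w.map β) = β (P.pi w)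

/-- A projection of partial groups: a homomorphism with `Dβ* = D'`. -/
def IsProjection (P : Data L) (P' : Data L') (β : L → L') : Prop :=
  IsHom P P' β ∧ ∀ w' ∈ P'.D, ∃ w ∈ P.D, w.map β = w'

/-- An isomorphism of partial groups: an injective projection. -/
def IsIsomorphism (P : Data L) (P' : Data L') (β : L → L') : Prop :=
  IsProjection P P' β ∧ Function.Injective β

/-- The kernel `ker(β) = {f : fβ = 1'}`. -/
def pgKer (P : Data L) (P' : Data L') (β : L → L') : Set L := {f | β f = P'.one}

/-- `β` restricted to the partial subgroup `L₀` is a homomorphism of partial groups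
(the source being `L₀` with the restricted product). -/
def IsHomBetween (P : Data L) (P' : Data L') (L₀ : Set L) (β : L → L') : Prop :=
  (∀ w ∈ P.D ∩ Wrd L₀, w.map β ∈ P'.D) ∧
    ∀ w ∈ P.D ∩ Wrd L₀, P'.pi (w.map β) = β (P.pi w)

/-- `β` restricted to a map `L₀ → L₀'` is a projection of partial groups between
the restricted partial groups on `L₀` and `L₀'` (so `(D ∩ W(L₀))β* = D' ∩ W(L₀')`). -/
def IsProjBetween (P : Data L) (P' : Data L') (L₀ : Set L) (L₀' : Set L') (β : L → L') :
    Prop :=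
  β '' L₀ = L₀' ∧ IsHomBetween P P' L₀ β ∧
    ∀ w' ∈ P'.D ∩ Wrd L₀', ∃ w ∈ P.D ∩ Wrd L₀, w.map β = w'

/-- `β` restricted to a map `L₀ → L₀'` is an isomorphism of partial groups. -/
def IsIsoBetween (P : Data L) (P' : Data L') (L₀ : Set L) (L₀' : Set L') (β : L → L') :
    Prop :=
  IsProjBetween P P' L₀ L₀' β ∧ Set.InjOn β L₀

/-- `chainFrom P Δ w Q` means: the word `w` lies in `D_Δ` via the chain starting at
`P₀ = Q`, i.e. there are `P₀,…,Pₙ ∈ Δ` with `P_{i-1} ⊆ D(f_i)` and `P_{i-1}^{f_i} = P_i`. -/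
def chainFrom (P : Data L) (Δ : Set (Set L)) : List L → Set L → Prop
  | [], _ => True
  | f :: w, Q => Q ⊆ P.Dconj f ∧ P.conjSet Q f ∈ Δ ∧ chainFrom P Δ w (P.conjSet Q f)

/-- The set of words `D_Δ`. -/
def DDelta (P : Data L) (Δ : Set (Set L)) : Set (List L) :=
  {w | ∃ Q ∈ Δ, chainFrom P Δ w Q}

/-- `(L,Δ,S)` is a locality (for the prime `p`). -/
structure IsLocality (p : ℕ) (P : Data L) (Δ : Set (Set L)) (S : Set L) : Prop where
  isPartialGroup : IsPartialGroup P
  /-- `L` is finite as a set. -/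
  finite : Finite L
  /-- `S` is a `p`-subgroup of `L`. -/
  pSubgroup : P.IsPSubgroup p S
  /-- `Δ` is nonempty. -/
  delta_nonempty : Δ.Nonempty
  /-- `Δ` is a set of subgroups of `S`. -/
  delta_subgroups : ∀ Q ∈ Δ, P.IsSubgroup Q ∧ Q ⊆ S
  /-- (L1): `S` is maximal among the `p`-subgroups of `L`. -/
  s_maximal : ∀ T : Set L, P.IsPSubgroup p T → S ⊆ T → T = S
  /-- (L2): `D = D_Δ`. -/
  d_eq : P.D = DDelta P Δ
  /-- (L3): overgroups in `S` of conjugates of members of `Δ` lie in `Δ`. -/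
  delta_closed : ∀ Q : Set L, P.IsSubgroup Q → Q ⊆ S →
    (∃ R ∈ Δ, ∃ g : L, R ⊆ P.Dconj g ∧ P.conjSet R g ⊆ Q) → Q ∈ Δ

/-- `(L₀,Δ,S)` is a locality, where `L₀` is a partial subgroup of the ambient partial
group and `L₀` is regarded as a partial group with the restricted product.  All the
conditions are expressed via the ambient product (with which the restricted one
agrees on words in `W(L₀)`). -/
structure IsLocalityIn (p : ℕ) (P : Data L) (L₀ : Set L) (Δ : Set (Set L)) (S : Set L) :
    Prop where
  partialSubgroup : P.IsPartialSubgroup L₀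
  /-- `L₀` is finite as a set. -/
  finite : L₀.Finite
  /-- `S` is a `p`-subgroup. -/
  pSubgroup : P.IsPSubgroup p S
  s_sub : S ⊆ L₀
  delta_nonempty : Δ.Nonempty
  delta_subgroups : ∀ Q ∈ Δ, P.IsSubgroup Q ∧ Q ⊆ S
  /-- (L1) for the restriction. -/
  s_maximal : ∀ T : Set L, T ⊆ L₀ → P.IsPSubgroup p T → S ⊆ T → T = S
  /-- (L2) for the restriction. -/
  d_eq : ∀ w ∈ Wrd L₀, (w ∈ P.D ↔ w ∈ DDelta P Δ)
  /-- (L3) for the restriction. -/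
  delta_closed : ∀ Q : Set L, P.IsSubgroup Q → Q ⊆ S →
    (∃ R ∈ Δ, ∃ g ∈ L₀, R ⊆ P.Dconj g ∧ P.conjSet R g ⊆ Q) → Q ∈ Δ

/-- `(L₀,Δ₀,S₀)` is a sublocality of a locality with Sylow subgroup `S`. -/
def IsSubLocality (p : ℕ) (P : Data L) (S : Set L) (L₀ : Set L) (Δ₀ : Set (Set L))
    (S₀ : Set L) : Prop :=
  S₀ = S ∩ L₀ ∧ IsLocalityIn p P L₀ Δ₀ S₀

/-- A projection of localities: a projection of partial groups with `Δβ = Δ'`. -/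
def IsLocalityProj (P : Data L) (P' : Data L') (Δ : Set (Set L)) (Δ' : Set (Set L'))
    (β : L → L') : Prop :=
  IsProjection P P' β ∧ Set.image β '' Δ = Δ'

/-- `β` restricted to `L₀ → L₀'` is a projection of localities. -/
def IsLocalityProjBetween (P : Data L) (P' : Data L') (L₀ : Set L) (Δ₀ : Set (Set L))
    (L₀' : Set L') (Δ₀' : Set (Set L')) (β : L → L') : Prop :=
  IsProjBetween P P' L₀ L₀' β ∧ Set.image β '' Δ₀ = Δ₀'

/-- The right coset `Nf = {Π(n,f) : n ∈ N, (n,f) ∈ D}`. -/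
def rightCoset (P : Data L) (N : Set L) (f : L) : Set L :=
  {y | ∃ n ∈ N, [n, f] ∈ P.D ∧ P.pi [n, f] = y}

/-- The data of the external direct product of two partial groups:  the domain consists
of the words whose words of first resp. second coordinates lie in the respective domains,
and the product and the inversion are computed coordinatewise. -/
def prodData (P₁ : Data L₁) (P₂ : Data L₂) : Data (L₁ × L₂) where
  D := {u | u.map Prod.fst ∈ P₁.D ∧ u.map Prod.snd ∈ P₂.D}
  pi := fun u => (P₁.pi (u.map Prod.fst), P₂.pi (u.map Prod.snd))
  inv := fun f => (P₁.inv f.1, P₂.inv f.2)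

/-- `Δ₁ * Δ₂`: the set of subgroups of `S₁ × S₂` containing some `P₁ × P₂` with
`P_i ∈ Δ_i`. -/
def deltaStar (P₁ : Data L₁) (P₂ : Data L₂) (Δ₁ : Set (Set L₁)) (Δ₂ : Set (Set L₂))
    (S₁ : Set L₁) (S₂ : Set L₂) : Set (Set (L₁ × L₂)) :=
  {Q | (prodData P₁ P₂).IsSubgroup Q ∧ Q ⊆ S₁ ×ˢ S₂ ∧
    ∃ R₁ ∈ Δ₁, ∃ R₂ ∈ Δ₂, R₁ ×ˢ R₂ ⊆ Q}

/-- `K` is a normal `p`-subgroup of the subgroup `M` of the ambient partial group. -/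
def Data.IsNormalPSubgroupIn (p : ℕ) (P : Data L) (M K : Set L) : Prop :=
  K ⊆ M ∧ P.IsSubgroup K ∧ (∃ n : ℕ, K.ncard = p ^ n) ∧
    ∀ f ∈ M, ∀ x ∈ K, x ∈ P.Dconj f ∧ P.conj x f ∈ K

/-- `O_p(M)`: the largest normal `p`-subgroup of the subgroup `M` (the union of all
normal `p`-subgroups of `M`). -/
def Data.pCoreIn (p : ℕ) (P : Data L) (M : Set L) : Set L :=
  ⋃₀ {K | P.IsNormalPSubgroupIn p M K}

/-- The subgroup `M` of the ambient partial group is of characteristic `p`: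
`C_M(O_p(M)) ≤ O_p(M)`. -/
def Data.IsCharPSubgroup (p : ℕ) (P : Data L) (M : Set L) : Prop :=
  P.centralizerIn M (P.pCoreIn p M) ⊆ P.pCoreIn p M

/-- A locality is of objective characteristic `p` if `N_L(Q)` is of characteristic `p`
for every `Q ∈ Δ`. -/
def IsObjectiveCharP (p : ℕ) (P : Data L) (Δ : Set (Set L)) : Prop :=
  ∀ Q ∈ Δ, P.IsCharPSubgroup p (P.normalizer Q)

/-- The word `(Π(f₁,g₁),…,Π(fₙ,gₙ))` built from the words `u = (f₁,…,fₙ)` and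
`v = (g₁,…,gₙ)`. -/
def zipProd (P : Data L) (u v : List L) : List L :=
  List.zipWith (fun f g => P.pi [f, g]) u v

/-- `L` is the internal central product of `M₁` and `M₂`: conditions (C1) and (C2). -/
def IsInternalCentralProduct (P : Data L) (M₁ M₂ : Set L) : Prop :=
  (P.D = {w | ∃ u v : List L, u ∈ P.D ∩ Wrd M₁ ∧ v ∈ P.D ∩ Wrd M₂ ∧
      u.length = v.length ∧ (∀ q ∈ u.zip v, [q.1, q.2] ∈ P.D) ∧ w = zipProd P u v}) ∧
  ∀ u v : List L, u ∈ P.D ∩ Wrd M₁ → v ∈ P.D ∩ Wrd M₂ → u.length = v.length →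
    (∀ q ∈ u.zip v, [q.1, q.2] ∈ P.D) →
    P.pi (zipProd P u v) = P.pi [P.pi u, P.pi v]

/-- `L` is the internal direct product of `M₁` and `M₂`: (C1), (C2) and (D). -/
def IsInternalDirectProduct (P : Data L) (M₁ M₂ : Set L) : Prop :=
  IsInternalCentralProduct P M₁ M₂ ∧
    ∀ h : L, ∃! fg : L × L, fg.1 ∈ M₁ ∧ fg.2 ∈ M₂ ∧ [fg.1, fg.2] ∈ P.D ∧
      P.pi [fg.1, fg.2] = h

namespace IsPartialGroup

variable {P : Data L} (hP : IsPartialGroup P)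
include hP

theorem nil_mem [Nonempty L] : [] ∈ P.D :=
  hP.append_left [] [Classical.arbitrary L] (hP.singleton_mem _)

theorem one_insert_mem {u w : List L} (h : u ++ w ∈ P.D) : u ++ [P.one] ++ w ∈ P.D :=
  hP.assoc_mem u [] w (by simpa using h)

theorem pi_one_insert {u w : List L} (h : u ++ w ∈ P.D) :
    P.pi (u ++ [P.one] ++ w) = P.pi (u ++ w) := by
  simpa [Data.one] using (hP.assoc_pi u [] w (by simpa using h)).symm

theorem wInv_wInv (w : List L) : P.wInv (P.wInv w) = w := by
  simp [Data.wInv, Function.comp_def, hP.inv_inv]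

theorem wInv_mem_D {w : List L} (h : w ∈ P.D) : P.wInv w ∈ P.D :=
  hP.append_left _ _ (hP.wInv_mem w h)

theorem mem_wInv {w : List L} (h : w ∈ P.D) : w ++ P.wInv w ∈ P.D := by
  simpa [hP.wInv_wInv] using hP.wInv_mem _ (hP.wInv_mem_D h)

theorem inv_mul_mem (f : L) : [P.inv f, f] ∈ P.D := hP.wInv_mem [f] (hP.singleton_mem f)

theorem inv_mul (f : L) : P.pi [P.inv f, f] = P.one := hP.wInv_pi [f] (hP.singleton_mem f)

theorem mul_inv (f : L) : P.pi [f, P.inv f] = P.one := by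
  simpa [hP.inv_inv] using hP.inv_mul (P.inv f)

theorem one_mul (f : L) : P.pi [P.one, f] = f :=
  (hP.pi_one_insert (u := []) (w := [f]) (hP.singleton_mem f)).trans (hP.pi_singleton f)

theorem mul_one (f : L) : P.pi [f, P.one] = f :=
  (hP.pi_one_insert (u := [f]) (w := []) (hP.singleton_mem f)).trans (hP.pi_singleton f)

/-- Left inverses are unique. -/
theorem eq_inv_of_mul_eq_one {a b : L} (h : [b, a] ∈ P.D) (h1 : P.pi [b, a] = P.one) :
    b = P.inv a := by
  have h2 : [b, a, P.inv a, P.inv b] ∈ P.D := hP.mem_wInv h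
  have h3 : [b, a, P.inv a] ∈ P.D := hP.append_left [b, a, P.inv a] [P.inv b] h2
  have e1 := hP.assoc_pi [] [b, a] [P.inv a] h3
  have e2 := hP.assoc_pi [b] [a, P.inv a] [] h3
  simp only [List.nil_append, List.cons_append, List.append_nil, h1, hP.one_mul, hP.mul_inv,
    hP.mul_one] at e1 e2
  exact e2.symm.trans e1

theorem inv_pi {w : List L} (h : w ∈ P.D) : P.inv (P.pi w) = P.pi (P.wInv w) := by
  have h0 := hP.wInv_mem w h
  have h1 : [P.pi (P.wInv w)] ++ w ∈ P.D := hP.assoc_mem [] (P.wInv w) w h0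
  have h2 : [P.pi (P.wInv w), P.pi w] ∈ P.D := by
    simpa using hP.assoc_mem [P.pi (P.wInv w)] w [] (by simpa using h1)
  refine (hP.eq_inv_of_mul_eq_one h2 ?_).symm
  have e1 := hP.assoc_pi [] (P.wInv w) w h0
  have e2 := hP.assoc_pi [P.pi (P.wInv w)] w [] (by simpa using h1)
  have e3 := hP.wInv_pi w h
  simp only [List.nil_append, List.append_nil] at e1 e2
  rw [e1, e2] at e3
  exact e3

theorem inv_one [Nonempty L] : P.inv P.one = P.one := hP.inv_pi hP.nil_mem

theorem conj_one [Nonempty L] (x : L) : x ∈ P.Dconj P.one ∧ P.conj x P.one = x := by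
  have h1 : [x, P.one] ∈ P.D :=
    hP.one_insert_mem (u := [x]) (w := []) (hP.singleton_mem x)
  have h2 : [P.one, x, P.one] ∈ P.D := hP.one_insert_mem (u := []) (w := [x, P.one]) h1
  refine ⟨by simpa [Data.Dconj, hP.inv_one] using h2, ?_⟩
  have e := hP.pi_one_insert (u := []) (w := [x, P.one]) h1
  simpa [Data.conj, hP.inv_one, hP.mul_one] using e

theorem one_conj (f : L) : P.conj P.one f = P.one :=
  (hP.pi_one_insert (u := [P.inv f]) (w := [f]) (hP.inv_mul_mem f)).trans (hP.inv_mul f)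

theorem conj_inv {x f : L} (h : x ∈ P.Dconj f) :
    P.conj x f ∈ P.Dconj (P.inv f) ∧ P.conj (P.conj x f) (P.inv f) = x := by
  have h0 : [P.inv f, x, f] ∈ P.D := h
  have h1 := hP.wInv_mem _ h0
  simp only [Data.wInv, List.map_cons, List.map_nil, List.reverse_cons, List.reverse_nil,
    List.nil_append, List.cons_append, hP.inv_inv] at h1
  have h2 : [f, P.inv f, x, f] ∈ P.D := hP.append_right [P.inv f, P.inv x] _ h1
  have h3 := hP.mem_wInv h2
  simp only [Data.wInv, List.map_cons, List.map_nil, List.reverse_cons, List.reverse_nil,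
    List.nil_append, List.cons_append, hP.inv_inv] at h3
  have h4 : [f, P.inv f, x, f, P.inv f] ∈ P.D :=
    hP.append_left [f, P.inv f, x, f, P.inv f] _ h3
  have h5 : [f, P.conj x f, P.inv f] ∈ P.D := hP.assoc_mem [f] [P.inv f, x, f] [P.inv f] h4
  refine ⟨by simpa [Data.Dconj, hP.inv_inv] using h5, ?_⟩
  have e1 := hP.assoc_pi [f] [P.inv f, x, f] [P.inv f] h4
  have e2 := hP.assoc_pi [] [f, P.inv f] [x, f, P.inv f] h4
  have h6 : [P.one, x, f, P.inv f] ∈ P.D := by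
    simpa [hP.mul_inv] using hP.assoc_mem [] [f, P.inv f] [x, f, P.inv f] h4
  have e3 := hP.pi_one_insert (u := []) (w := [x, f, P.inv f])
    (hP.append_right [P.one] _ h6)
  have e4 := hP.assoc_pi [x] [f, P.inv f] [] (hP.append_right [P.one] _ h6)
  simp only [List.nil_append, List.cons_append, List.append_nil, hP.mul_inv,
    hP.mul_one] at e1 e2 e3 e4
  rw [Data.conj, hP.inv_inv]
  exact e1.symm.trans (e2.trans (e3.trans e4))

theorem conjSet_inv {X : Set L} {f : L} (h : X ⊆ P.Dconj f) :
    P.conjSet X f ⊆ P.Dconj (P.inv f) ∧ P.conjSet (P.conjSet X f) (P.inv f) = X := by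
  constructor
  · rintro _ ⟨x, hx, rfl⟩
    exact (hP.conj_inv (h hx)).1
  · rw [Data.conjSet, Data.conjSet, Set.image_image]
    exact (Set.image_congr fun x hx => (hP.conj_inv (h hx)).2).trans (Set.image_id' X)

theorem conj_mul {a b f : L} (h : [P.inv f, a, f, P.inv f, b, f] ∈ P.D) :
    P.pi [P.conj a f, P.conj b f] = P.conj (P.pi [a, b]) f := by
  have e1 := hP.assoc_pi [] [P.inv f, a, f] [P.inv f, b, f] h
  have h1 : [P.conj a f, P.inv f, b, f] ∈ P.D :=
    hP.assoc_mem [] [P.inv f, a, f] [P.inv f, b, f] h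
  have e2 := hP.assoc_pi [P.conj a f] [P.inv f, b, f] [] h1
  have e3 := hP.assoc_pi [P.inv f, a] [f, P.inv f] [b, f] h
  have h2 : [P.inv f, a, P.one, b, f] ∈ P.D := by
    simpa [hP.mul_inv] using hP.assoc_mem [P.inv f, a] [f, P.inv f] [b, f] h
  have h3 : [a, P.one, b, f] ∈ P.D := hP.append_right [P.inv f] _ h2
  have e4 := hP.assoc_pi [P.inv f] [a, P.one, b] [f] h2
  have e5 := hP.assoc_pi [] [a, P.one] [b] (hP.append_left [a, P.one, b] [f] h3)
  simp only [List.nil_append, List.cons_append, List.append_nil, hP.mul_inv,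
    hP.mul_one] at e1 e2 e3 e4 e5
  rw [e5] at e4
  exact e2.symm.trans (e1.symm.trans (e3.trans e4))

theorem conj_inv_elt {a f : L} (h : a ∈ P.Dconj f) :
    P.inv a ∈ P.Dconj f ∧ P.inv (P.conj a f) = P.conj (P.inv a) f := by
  have e : P.wInv [P.inv f, a, f] = [P.inv f, P.inv a, f] := by
    simp [Data.wInv, hP.inv_inv]
  have h0 : [P.inv f, a, f] ∈ P.D := h
  have h1 := hP.wInv_mem_D h0
  have h2 := hP.inv_pi h0
  rw [e] at h1 h2
  exact ⟨h1, h2⟩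

end IsPartialGroup

namespace Data.IsSubgroup

variable {P : Data L} {H : Set L}

theorem pair_mem (hH : P.IsSubgroup H) {a b : L} (ha : a ∈ H) (hb : b ∈ H) :
    [a, b] ∈ P.D := hH.2 (by simp [Wrd, ha, hb])

theorem mul_mem (hH : P.IsSubgroup H) {a b : L} (ha : a ∈ H) (hb : b ∈ H) :
    P.pi [a, b] ∈ H :=
  hH.1.2 _ ⟨by simp [Wrd, ha, hb], hH.pair_mem ha hb⟩

theorem one_mem (hH : P.IsSubgroup H) : P.one ∈ H :=
  hH.1.2 [] ⟨by simp [Wrd], hH.2 (by simp [Wrd])⟩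

/-- A subgroup of a partial group is a group under the binary product. -/
abbrev group (hP : IsPartialGroup P) (hH : P.IsSubgroup H) : Group H :=
  letI : Mul H := ⟨fun a b => ⟨P.pi [a, b], hH.mul_mem a.2 b.2⟩⟩
  letI : One H := ⟨⟨P.one, hH.one_mem⟩⟩
  letI : Inv H := ⟨fun a => ⟨P.inv a, hH.1.1 _ a.2⟩⟩
  Group.ofLeftAxioms
    (fun a b c => Subtype.ext <| by
      have h : [a.1, b.1, c.1] ∈ P.D := hH.2 (by simp [Wrd])
      exact (hP.assoc_pi [] [a.1, b.1] [c.1] h).symm.trans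
        (hP.assoc_pi [a.1] [b.1, c.1] [] h))
    (fun a => Subtype.ext (hP.one_mul a))
    (fun a => Subtype.ext (hP.inv_mul a))

theorem of_mul_mem (hP : IsPartialGroup P) (hH : P.IsSubgroup H) {X : Set L} (hX : X ⊆ H)
    (h1 : P.one ∈ X) (hinv : ∀ a ∈ X, P.inv a ∈ X)
    (hmul : ∀ a ∈ X, ∀ b ∈ X, P.pi [a, b] ∈ X) : P.IsSubgroup X := by
  have hD : Wrd X ⊆ P.D := fun w hw => hH.2 fun x hx => hX (hw x hx)
  refine ⟨⟨hinv, fun w hw => ?_⟩, hD⟩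
  have key : ∀ w ∈ Wrd X, P.pi w ∈ X := by
    intro w
    induction w with
    | nil => exact fun _ => h1
    | cons a w ih =>
      intro hw
      have hw' : w ∈ Wrd X := fun x hx => hw x (List.mem_cons_of_mem _ hx)
      have e := hP.assoc_pi [a] w [] (by simpa using hD hw)
      simp only [List.cons_append, List.nil_append, List.append_nil] at e
      rw [e]
      exact hmul _ (hw a List.mem_cons_self) _ (ih hw')
  exact key w hw.1

theorem image_val (hP : IsPartialGroup P) (hH : P.IsSubgroup H) :
    letI := hH.group hP
    ∀ K : Subgroup H, P.IsSubgroup (Subtype.val '' (K : Set H)) := by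
  let _ := hH.group hP
  intro K
  refine of_mul_mem hP hH (by rintro _ ⟨x, -, rfl⟩; exact x.2) ⟨1, K.one_mem, rfl⟩ ?_ ?_
  · rintro _ ⟨x, hx, rfl⟩
    exact ⟨x⁻¹, K.inv_mem hx, rfl⟩
  · rintro _ ⟨x, hx, rfl⟩ _ ⟨y, hy, rfl⟩
    exact ⟨x * y, K.mul_mem hx hy, rfl⟩

/-- A subgroup contained in `H`, as a `Subgroup` of the group `H`. -/
abbrev toSubgroup (hP : IsPartialGroup P) (hH : P.IsSubgroup H) {X : Set L}
    (hX : P.IsSubgroup X) : @Subgroup H (hH.group hP) :=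
  letI := hH.group hP
  { carrier := Subtype.val ⁻¹' X
    mul_mem' := fun ha hb => hX.mul_mem ha hb
    one_mem' := hX.one_mem
    inv_mem' := fun ha => hX.1.1 _ ha }

theorem conjSet (hP : IsPartialGroup P) (hH : P.IsSubgroup H) {X : Set L} {f : L}
    (hX : P.IsSubgroup X)
    (hD : ∀ a ∈ X, ∀ b ∈ X, [P.inv f, a, f, P.inv f, b, f] ∈ P.D)
    (hsub : P.conjSet X f ⊆ H) : P.IsSubgroup (P.conjSet X f) := by
  refine of_mul_mem hP hH hsub ⟨P.one, hX.one_mem, hP.one_conj f⟩ ?_ ?_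
  · rintro _ ⟨a, ha, rfl⟩
    exact ⟨P.inv a, hX.1.1 _ ha,
      (hP.conj_inv_elt (hP.append_left [P.inv f, a, f] _ (hD a ha a ha))).2.symm⟩
  · rintro _ ⟨a, ha, rfl⟩ _ ⟨b, hb, rfl⟩
    exact ⟨_, hX.mul_mem ha hb, (hP.conj_mul (hD a ha b hb)).symm⟩

theorem subset_Dconj (hH : P.IsSubgroup H) {X : Set L} (hX : X ⊆ H) {s : L} (hs : s ∈ H) :
    X ⊆ P.Dconj s :=
  fun x hx => hH.2 (by simp [Wrd, hs, hX hx, hH.1.1 s hs])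

end Data.IsSubgroup

/-- `f` conjugates the object `Q` onto the object `R`. -/
def Step (P : Data L) (Δ : Set (Set L)) (f : L) (Q R : Set L) : Prop :=
  Q ∈ Δ ∧ R ∈ Δ ∧ Q ⊆ P.Dconj f ∧ P.conjSet Q f = R

/-- The successive letters of a word conjugate the object `Q` through objects onto `R`. -/
inductive Path (P : Data L) (Δ : Set (Set L)) : List L → Set L → Set L → Prop
  | nil {Q : Set L} : Q ∈ Δ → Path P Δ [] Q Q
  | cons {f : L} {w : List L} {Q R T : Set L} :
      Step P Δ f Q R → Path P Δ w R T → Path P Δ (f :: w) Q T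

section Localities

variable {P : Data L} {Δ : Set (Set L)} {S : Set L} {p : ℕ}

theorem Step.singleton {f : L} {Q R : Set L} (h : Step P Δ f Q R) : Path P Δ [f] Q R :=
  .cons h (.nil h.2.1)

theorem Path.append {u v : List L} {Q R T : Set L} (hu : Path P Δ u Q R)
    (hv : Path P Δ v R T) : Path P Δ (u ++ v) Q T := by
  induction hu with
  | nil _ => exact hv
  | cons h _ ih => exact .cons h (ih hv)

theorem chainFrom_iff_path {w : List L} {Q : Set L} (hQ : Q ∈ Δ) :
    chainFrom P Δ w Q ↔ ∃ R, Path P Δ w Q R := by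
  induction w generalizing Q with
  | nil => exact ⟨fun _ => ⟨Q, .nil hQ⟩, fun _ => trivial⟩
  | cons f w ih =>
    constructor
    · rintro ⟨h1, h2, h3⟩
      obtain ⟨R, hR⟩ := (ih h2).1 h3
      exact ⟨R, .cons ⟨hQ, h2, h1, rfl⟩ hR⟩
    · rintro ⟨R, hR⟩
      cases hR with
      | cons hs hp =>
        obtain ⟨-, h2, h3, rfl⟩ := hs
        exact ⟨h3, h2, (ih h2).2 ⟨_, hp⟩⟩

theorem Path.left_mem {w : List L} {Q R : Set L} (h : Path P Δ w Q R) : Q ∈ Δ := by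
  cases h with
  | nil h => exact h
  | cons h _ => exact h.1

theorem Path.right_mem {w : List L} {Q R : Set L} (h : Path P Δ w Q R) : R ∈ Δ := by
  induction h with
  | nil h => exact h
  | cons _ _ ih => exact ih

theorem Step.inv (hP : IsPartialGroup P) {f : L} {Q R : Set L} (h : Step P Δ f Q R) :
    Step P Δ (P.inv f) R Q := by
  obtain ⟨h1, h2, h3, rfl⟩ := h
  exact ⟨h2, h1, hP.conjSet_inv h3⟩

theorem step_of_mem_center {z : L} (hz : z ∈ P.center) {Q : Set L} (hQ : Q ∈ Δ) :
    Step P Δ z Q Q :=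
  ⟨hQ, hQ, fun x _ => (hz x trivial).1,
    (Set.image_congr fun x _ => (hz x trivial).2).trans (Set.image_id' Q)⟩

namespace IsLocality

variable (hloc : IsLocality p P Δ S)
include hloc

theorem mem_D_iff {w : List L} : w ∈ P.D ↔ ∃ Q R, Path P Δ w Q R := by
  rw [hloc.d_eq]
  constructor
  · rintro ⟨Q, hQ, h⟩
    exact ⟨Q, (chainFrom_iff_path hQ).1 h⟩
  · rintro ⟨Q, R, h⟩
    exact ⟨Q, h.left_mem, (chainFrom_iff_path h.left_mem).2 ⟨R, h⟩⟩

theorem mem_D {w : List L} {Q R : Set L} (h : Path P Δ w Q R) : w ∈ P.D :=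
  hloc.mem_D_iff.2 ⟨Q, R, h⟩

theorem exists_step (f : L) : ∃ Q R, Step P Δ f Q R := by
  obtain ⟨Q, R, h⟩ := hloc.mem_D_iff.1 (hloc.isPartialGroup.singleton_mem f)
  cases h with
  | cons h _ => exact ⟨_, _, h⟩

theorem isSubgroup_S : P.IsSubgroup S := hloc.pSubgroup.1

theorem mem_delta_of_superset {Q R : Set L} (hQ : Q ∈ Δ) (hR : P.IsSubgroup R) (hRS : R ⊆ S)
    (hQR : Q ⊆ R) : R ∈ Δ := by
  have : Nonempty L := ⟨P.one⟩
  have h1 := hloc.isPartialGroup.conj_one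
  refine hloc.delta_closed R hR hRS ⟨Q, hQ, P.one, fun x _ => (h1 x).1, ?_⟩
  rintro _ ⟨x, hx, rfl⟩
  simpa [(h1 x).2] using hQR hx

theorem S_mem_delta : S ∈ Δ := by
  obtain ⟨Q, hQ⟩ := hloc.delta_nonempty
  exact hloc.mem_delta_of_superset hQ hloc.isSubgroup_S subset_rfl (hloc.delta_subgroups Q hQ).2

theorem step_of_mem_S {s : L} (hs : s ∈ S) {Q : Set L} (hQ : Q ∈ Δ) :
    Step P Δ s Q (P.conjSet Q s) := by
  have hS := hloc.isSubgroup_S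
  obtain ⟨hQ1, hQ2⟩ := hloc.delta_subgroups Q hQ
  have hD := hS.subset_Dconj hQ2 hs
  have hsub : P.conjSet Q s ⊆ S := by
    rintro _ ⟨x, hx, rfl⟩
    exact hS.1.2 _ ⟨by simp [Wrd, hs, hQ2 hx, hS.1.1 s hs], hD hx⟩
  refine ⟨hQ, hloc.delta_closed _ ?_ hsub ⟨Q, hQ, s, hD, subset_rfl⟩, hD, rfl⟩
  refine Data.IsSubgroup.conjSet hloc.isPartialGroup hS hQ1 (fun a ha b hb => hS.2 ?_) hsub
  simp [Wrd, hs, hQ2 ha, hQ2 hb, hS.1.1 s hs]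

theorem step_self {Q : Set L} (hQ : Q ∈ Δ) {s : L} (hs : s ∈ Q) : Step P Δ s Q Q := by
  have hP := hloc.isPartialGroup
  have hQ1 := (hloc.delta_subgroups Q hQ).1
  have hmem : ∀ t ∈ Q, P.conjSet Q t ⊆ Q := by
    rintro t ht _ ⟨x, hx, rfl⟩
    have : [P.inv t, x, t] ∈ Wrd Q := by simp [Wrd, ht, hx, hQ1.1.1 t ht]
    exact hQ1.1.2 _ ⟨this, hQ1.2 this⟩
  have hD := hQ1.subset_Dconj subset_rfl hs
  refine ⟨hQ, hQ, hD, (hmem s hs).antisymm ?_⟩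
  have hi := hQ1.1.1 s hs
  have e := (hP.conjSet_inv (hQ1.subset_Dconj subset_rfl hi)).2
  rw [hP.inv_inv] at e
  conv_lhs => rw [← e]
  exact Set.image_mono (hmem _ hi)

theorem step_mul {f g : L} {Q R T : Set L} (hf : Step P Δ f Q R) (hg : Step P Δ g R T) :
    Step P Δ (P.pi [f, g]) Q T := by
  have hP := hloc.isPartialGroup
  have hfg : [f, g] ∈ P.D := hloc.mem_D (.cons hf hg.singleton)
  have einv : P.inv (P.pi [f, g]) = P.pi [P.inv g, P.inv f] := hP.inv_pi hfg
  have key : ∀ x ∈ Q, x ∈ P.Dconj (P.pi [f, g]) ∧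
      P.conj x (P.pi [f, g]) = P.conj (P.conj x f) g := by
    intro x hx
    have h : [P.inv g, P.inv f, x, f, g] ∈ P.D :=
      hloc.mem_D (.cons (hg.inv hP) (.cons (hf.inv hP) (.cons (hloc.step_self hf.1 hx)
        (.cons hf hg.singleton))))
    have h1 : [P.pi [P.inv g, P.inv f], x, f, g] ∈ P.D :=
      hP.assoc_mem [] [P.inv g, P.inv f] [x, f, g] h
    have h2 : [P.pi [P.inv g, P.inv f], x, P.pi [f, g]] ∈ P.D :=
      hP.assoc_mem [P.pi [P.inv g, P.inv f], x] [f, g] [] h1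
    refine ⟨by simpa [Data.Dconj, einv] using h2, ?_⟩
    have e1 := hP.assoc_pi [] [P.inv g, P.inv f] [x, f, g] h
    have e2 := hP.assoc_pi [P.pi [P.inv g, P.inv f], x] [f, g] [] h1
    have e3 := hP.assoc_pi [P.inv g] [P.inv f, x, f] [g] h
    simp only [Data.conj, einv]
    exact e2.symm.trans (e1.symm.trans e3)
  refine ⟨hf.1, hg.2.1, fun x hx => (key x hx).1, ?_⟩
  rw [← hg.2.2.2, ← hf.2.2.2, Data.conjSet, Data.conjSet, Data.conjSet, Set.image_image]
  exact Set.image_congr fun x hx => (key x hx).2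

/-- The normalizer of an object is a subgroup. -/
theorem isSubgroup_normalizer {Q : Set L} (hQ : Q ∈ Δ) : P.IsSubgroup (P.normalizer Q) := by
  have hP := hloc.isPartialGroup
  have : Nonempty L := ⟨P.one⟩
  have hstep : ∀ g ∈ P.normalizer Q, Step P Δ g Q Q := fun g hg => ⟨hQ, hQ, hg.1, hg.2⟩
  have hpath : ∀ w ∈ Wrd (P.normalizer Q), Path P Δ w Q Q := by
    intro w
    induction w with
    | nil => exact fun _ => .nil hQ
    | cons a w ih =>
      exact fun hw => .cons (hstep a (hw a List.mem_cons_self))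
        (ih fun x hx => hw x (List.mem_cons_of_mem _ hx))
  have hprod : ∀ w ∈ Wrd (P.normalizer Q), Step P Δ (P.pi w) Q Q := by
    intro w
    induction w with
    | nil =>
      exact fun _ => ⟨hQ, hQ, fun x _ => (hP.conj_one x).1,
        (Set.image_congr fun x _ => (hP.conj_one x).2).trans (Set.image_id' Q)⟩
    | cons a w ih =>
      intro hw
      have e := hP.assoc_pi [a] w [] (by simpa using hloc.mem_D (hpath _ hw))
      simp only [List.cons_append, List.nil_append, List.append_nil] at e
      rw [e]
      exact hloc.step_mul (hstep a (hw a List.mem_cons_self))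
        (ih fun x hx => hw x (List.mem_cons_of_mem _ hx))
  refine ⟨⟨fun f hf => ?_, fun w hw => ?_⟩, fun w hw => hloc.mem_D (hpath w hw)⟩
  · exact ((hstep f hf).inv hP).2.2
  · exact (hprod w hw.1).2.2

theorem isPGroup_S [Fact p.Prime] :
    letI := hloc.isSubgroup_S.group hloc.isPartialGroup
    IsPGroup p S := by
  let _ := hloc.isSubgroup_S.group hloc.isPartialGroup
  obtain ⟨n, hn⟩ := hloc.pSubgroup.2
  exact IsPGroup.of_card (n := n) hn

/-- Elements of `p`-power order normalizing `S` lie in `S`. -/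
theorem mem_S_of_pow_eq_one [Fact p.Prime] :
    letI := (hloc.isSubgroup_normalizer hloc.S_mem_delta).group hloc.isPartialGroup
    ∀ (v : P.normalizer S) (n : ℕ), v ^ p ^ n = 1 → (v : L) ∈ S := by
  have hP := hloc.isPartialGroup
  have hM := hloc.isSubgroup_normalizer hloc.S_mem_delta
  let _ := hM.group hP
  intro v n hv
  have : Finite L := hloc.finite
  let K : Subgroup (P.normalizer S) := hM.toSubgroup hP hloc.isSubgroup_S
  have hSM : S ⊆ P.normalizer S := fun s hs => (hloc.step_self hloc.S_mem_delta hs).2.2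
  have hKn : K.Normal := by
    refine ⟨fun x hx g => ?_⟩
    have hg : Step P Δ (g⁻¹).1 S S := ⟨hloc.S_mem_delta, hloc.S_mem_delta, (g⁻¹).2⟩
    have h1 : P.conj x (g⁻¹).1 ∈ S := hg.2.2.2.subset ⟨x, hx, rfl⟩
    have e : P.inv (g⁻¹).1 = g := hP.inv_inv _
    have h2 : [(g : L), (x : L), (g⁻¹).1] ∈ P.D :=
      hM.2 (by simp only [Wrd, Set.mem_ofPred_eq, List.forall_mem_cons, Subtype.coe_prop,
        List.not_mem_nil, false_implies, implies_true, and_self])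
    have e2 := hP.assoc_pi [] [(g : L), (x : L)] [(g⁻¹).1] h2
    rw [Data.conj, e] at h1
    change P.pi [P.pi [(g : L), (x : L)], (g⁻¹).1] ∈ S
    exact e2 ▸ h1
  have hKp : IsPGroup p K := by
    obtain ⟨m, hm⟩ := hloc.pSubgroup.2
    refine IsPGroup.of_card (n := m) ?_
    rw [← hm]
    refine Set.ncard_preimage_of_injective_subset_range Subtype.val_injective ?_
    rwa [Subtype.range_coe]
  have hzp : IsPGroup p (Subgroup.zpowers v) := by
    rintro ⟨x, k, rfl⟩
    refine ⟨n, Subtype.ext ?_⟩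
    change (v ^ k) ^ p ^ n = 1
    rw [← zpow_natCast, zpow_comm, zpow_natCast, hv, one_zpow]
  have hT : IsPGroup p (K ⊔ Subgroup.zpowers v : Subgroup (P.normalizer S)) :=
    hKp.to_sup_of_normal_left hzp
  obtain ⟨m, hm⟩ := IsPGroup.iff_card.1 hT
  have hTL : P.IsPSubgroup p
      (Subtype.val '' ((K ⊔ Subgroup.zpowers v : Subgroup (P.normalizer S)) : Set _)) :=
    ⟨hM.image_val hP _, m, by
      rw [Set.ncard_image_of_injective _ Subtype.val_injective]
      exact hm⟩
  have hST := hloc.s_maximal _ hTL fun s hs => ⟨⟨s, hSM hs⟩, le_sup_left (a := K) hs, rfl⟩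
  exact hST.subset ⟨v, le_sup_right (a := K) (Subgroup.mem_zpowers v), rfl⟩

/-- A path can be extended by elements of `S` on both sides. -/
theorem exists_path_surround {w : List L} {Q R : Set L} (h : Path P Δ w Q R) {x y : L}
    (hx : x ∈ S) (hy : y ∈ S) : ∃ Q' R', Path P Δ (x :: (w ++ [y])) Q' R' := by
  have hP := hloc.isPartialGroup
  have h1 := (hloc.step_of_mem_S (hloc.isSubgroup_S.1.1 x hx) h.left_mem).inv hP
  rw [hP.inv_inv] at h1
  exact ⟨_, _, .cons h1 (h.append (hloc.step_of_mem_S hy h.right_mem).singleton)⟩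

end IsLocality

end Localities

namespace IsHom

variable {P : Data L} {P' : Data L'} {β : L → L'}

theorem map_one [Nonempty L] (hβ : IsHom P P' β) (hP : IsPartialGroup P) :
    β P.one = P'.one :=
  (hβ.2 [] hP.nil_mem).symm

theorem map_inv [Nonempty L] (hβ : IsHom P P' β) (hP : IsPartialGroup P)
    (hP' : IsPartialGroup P') (f : L) : β (P.inv f) = P'.inv (β f) := by
  have h := hP.inv_mul_mem f
  refine hP'.eq_inv_of_mul_eq_one (hβ.1 _ h) ?_
  rw [← hβ.map_one hP, ← hP.inv_mul f]
  exact hβ.2 _ h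

end IsHom

/-- In a finite `p`-group, a subgroup that contains its normalizer in a larger subgroup is
the whole of the latter. -/
theorem _root_.IsPGroup.le_of_inf_normalizer_le {p : ℕ} [Fact p.Prime] {G : Type*} [Group G]
    [Finite G] (hG : IsPGroup p G) {Q B : Subgroup G} (hQB : Q ≤ B)
    (h : B ⊓ Subgroup.normalizer (Q : Set G) ≤ Q) : B ≤ Q := by
  have hB : Group.IsNilpotent B := (hG.to_subgroup B).isNilpotent
  by_contra hne
  have hlt : Q.subgroupOf B < ⊤ :=
    lt_top_iff_ne_top.2 fun e => hne (Subgroup.subgroupOf_eq_top.1 e)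
  obtain ⟨x, hx, hxQ⟩ := SetLike.exists_of_lt (Group.normalizerCondition_of_isNilpotent _ hlt)
  refine hxQ (Subgroup.mem_subgroupOf.2 (h ⟨x.2, ?_⟩))
  change (x : G) ∈ Subgroup.normalizer (Q : Set G)
  rw [Subgroup.mem_normalizer_iff] at hx ⊢
  intro g
  constructor
  · intro hg
    exact (hx ⟨g, hQB hg⟩).1 hg
  · intro hg
    have hgB : g ∈ B := by
      have := B.mul_mem (B.mul_mem (B.inv_mem x.2) (hQB hg)) x.2
      simpa [mul_assoc] using this
    exact (hx ⟨g, hgB⟩).2 hg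

/-- The elements `x` of `S` such that `x` on the left and some element of `S` on the right
jointly fix `g'` in the image of `β`. -/
def leftStabilizer (P' : Data L') (β : L → L') (S : Set L) (g' : L') : Set L :=
  {x | x ∈ S ∧ ∃ y ∈ S, P'.pi [β x, g', β y] = g'}

namespace IsLocality

variable {P : Data L} {Δ : Set (Set L)} {S : Set L} {p : ℕ} {P' : Data L'} {β : L → L'}

theorem isSubgroup_leftStabilizer (hloc : IsLocality p P Δ S) (hP' : IsPartialGroup P')
    (hβ : IsHom P P' β) (f : L) : P.IsSubgroup (leftStabilizer P' β S (β f)) := by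
  have hP := hloc.isPartialGroup
  have hS := hloc.isSubgroup_S
  have : Nonempty L := ⟨f⟩
  obtain ⟨Q, R, hf⟩ := hloc.exists_step f
  have key : ∀ a ∈ S, ∀ x ∈ S, ∀ y ∈ S, ∀ b ∈ S, P'.pi [β x, β f, β y] = β f →
      P'.pi [β (P.pi [a, x]), β f, β (P.pi [y, b])] = P'.pi [β a, β f, β b] := by
    intro a ha x hx y hy b hb h
    obtain ⟨_, _, h1⟩ := hloc.exists_path_surround hf.singleton hx hy
    obtain ⟨_, _, h2⟩ := hloc.exists_path_surround h1 ha hb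
    have hD : [a, x, f, y, b] ∈ P.D := hloc.mem_D h2
    have hD1 : [P.pi [a, x], f, y, b] ∈ P.D := hP.assoc_mem [] [a, x] [f, y, b] hD
    have hD2 : [P.pi [a, x], f, P.pi [y, b]] ∈ P.D :=
      hP.assoc_mem [P.pi [a, x], f] [y, b] [] hD1
    have hD' : [β a, β x, β f, β y, β b] ∈ P'.D := hβ.1 _ hD
    have e1 : P'.pi [β (P.pi [a, x]), β f, β (P.pi [y, b])] =
        β (P.pi [P.pi [a, x], f, P.pi [y, b]]) := hβ.2 _ hD2
    have e2 : P.pi [P.pi [a, x], f, P.pi [y, b]] = P.pi [a, x, f, y, b] :=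
      ((hP.assoc_pi [] [a, x] [f, y, b] hD).trans
        (hP.assoc_pi [P.pi [a, x], f] [y, b] [] hD1)).symm
    have e3 : P'.pi [β a, β x, β f, β y, β b] = β (P.pi [a, x, f, y, b]) := hβ.2 _ hD
    have e4 := hP'.assoc_pi [β a] [β x, β f, β y] [β b] hD'
    rw [h] at e4
    rw [e1, e2, ← e3]
    exact e4
  have hone : P'.pi [β P.one, β f, β P.one] = β f := by
    rw [hβ.map_one hP]
    have h2 : [P'.one, β f] ∈ P'.D :=
      hP'.one_insert_mem (u := []) (w := [β f]) (hP'.singleton_mem _)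
    exact (hP'.pi_one_insert (u := [P'.one, β f]) (w := []) h2).trans (hP'.one_mul _)
  refine Data.IsSubgroup.of_mul_mem hP hS (fun x hx => hx.1)
    ⟨hS.one_mem, P.one, hS.one_mem, hone⟩ ?_ ?_
  · rintro x ⟨hx, y, hy, h⟩
    have hx' := hS.1.1 x hx
    have hy' := hS.1.1 y hy
    refine ⟨hx', P.inv y, hy', ?_⟩
    have e := key _ hx' x hx y hy _ hy' h
    rw [hP.inv_mul, hP.mul_inv, hone] at e
    exact e.symm
  · rintro a ⟨ha, b, hb, hab⟩ x ⟨hx, y, hy, h⟩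
    exact ⟨hS.mul_mem ha hx, P.pi [y, b], hS.mul_mem hy hb,
      (key a ha x hx y hy b hb h).trans hab⟩

/-- If `f` conjugates the object `Q` into `S`, then `Q` lies in the left stabilizer of the
image of `f`. -/
theorem subset_leftStabilizer (hloc : IsLocality p P Δ S) (hβ : IsHom P P' β) {f : L}
    {Q R : Set L} (hf : Step P Δ f Q R) : Q ⊆ leftStabilizer P' β S (β f) := by
  have hP := hloc.isPartialGroup
  intro q hq
  have hqR : P.conj q f ∈ R := hf.2.2.2.subset ⟨q, hq, rfl⟩
  have hqS := (hloc.delta_subgroups _ hf.1).2 hq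
  have hrS := hloc.isSubgroup_S.1.1 _ ((hloc.delta_subgroups _ hf.2.1).2 hqR)
  refine ⟨hqS, _, hrS, ?_⟩
  have hq' := (hloc.delta_subgroups _ hf.1).1.1.1 q hq
  have hD : [q, f, P.inv f, P.inv q, f] ∈ P.D :=
    hloc.mem_D (.cons (hloc.step_self hf.1 hq) (.cons hf (.cons (hf.inv hP)
      (.cons (hloc.step_self hf.1 hq') hf.singleton))))
  have hr : P.inv (P.conj q f) = P.pi [P.inv f, P.inv q, f] :=
    (hP.conj_inv_elt (hf.2.2.1 hq)).2
  have hD1 : [q, f, P.inv (P.conj q f)] ∈ P.D := by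
    rw [hr]
    exact hP.assoc_mem [q, f] [P.inv f, P.inv q, f] [] hD
  refine (hβ.2 _ hD1).trans (congrArg β ?_)
  rw [hr]
  have e1 := hP.assoc_pi [q, f] [P.inv f, P.inv q, f] [] hD
  have e2 := hP.assoc_pi [q] [f, P.inv f] [P.inv q, f] hD
  have hD2 : [q, P.one, P.inv q, f] ∈ P.D := by
    simpa [hP.mul_inv] using hP.assoc_mem [q] [f, P.inv f] [P.inv q, f] hD
  have e3 := hP.assoc_pi [] [q, P.one] [P.inv q, f] hD2
  have hD3 : [q, P.inv q, f] ∈ P.D := by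
    simpa [hP.mul_one] using hP.assoc_mem [] [q, P.one] [P.inv q, f] hD2
  have e4 := hP.assoc_pi [] [q, P.inv q] [f] hD3
  simp only [List.nil_append, List.cons_append, List.append_nil, hP.mul_inv,
    hP.mul_one, hP.one_mul] at e1 e2 e3 e4
  exact e1.symm.trans (e2.trans (e3.trans e4))

/-- Elements of the left stabilizer of the image of `f` that normalize an object conjugated
by `f` to an object are themselves conjugated by `f` into `S`. -/
theorem conj_mem_S_of_mem_leftStabilizer [Fact p.Prime] (hloc : IsLocality p P Δ S)
    (hP' : IsPartialGroup P') (hβ : IsHom P P' β) (hker : pgKer P P' β ⊆ P.center) {f : L}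
    {Q R : Set L} (hf : Step P Δ f Q R) {s : L} (hs : s ∈ leftStabilizer P' β S (β f))
    (hsQ : Step P Δ s Q Q) : P.conj s f ∈ S := by
  have hP := hloc.isPartialGroup
  have hS := hloc.isSubgroup_S
  have : Nonempty L := ⟨f⟩
  obtain ⟨hsS, t, ht, hst⟩ := hs
  have ht' := hS.1.1 t ht
  have hp0 : Path P Δ [P.inv f, s, f] R R := .cons (hf.inv hP) (.cons hsQ hf.singleton)
  have hp1 : Path P Δ [P.inv f, s, f, t] R _ :=
    hp0.append (hloc.step_of_mem_S ht hf.2.1).singleton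
  have hD1 : [P.inv f, s, f, t] ∈ P.D := hloc.mem_D hp1
  have hD2 : [P.inv f, s, f, t, P.inv t] ∈ P.D :=
    hloc.mem_D (hp1.append (hloc.step_of_mem_S ht' hp1.right_mem).singleton)
  have hzker : P.pi [P.inv f, s, f, t] ∈ pgKer P P' β := by
    have e1 : P'.pi [β (P.inv f), β s, β f, β t] = β (P.pi [P.inv f, s, f, t]) :=
      hβ.2 _ hD1
    have e2 := hP'.assoc_pi [β (P.inv f)] [β s, β f, β t] [] (hβ.1 _ hD1)
    rw [hst, hβ.map_inv hP hP'] at e2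
    rw [hβ.map_inv hP hP'] at e1
    exact e1.symm.trans (e2.trans (hP'.inv_mul _))
  have hv : P.conj s f = P.pi [P.pi [P.inv f, s, f, t], P.inv t] := by
    have e1 := hP.assoc_pi [] [P.inv f, s, f, t] [P.inv t] hD2
    have e2 := hP.assoc_pi [P.inv f, s, f] [t, P.inv t] [] hD2
    have e3 := hP.pi_one_insert (u := [P.inv f, s, f]) (w := []) (hloc.mem_D hp0)
    simp only [List.nil_append, List.cons_append, List.append_nil, hP.mul_inv] at e1 e2 e3
    exact e3.symm.trans (e2.symm.trans e1)
  have hvS : Step P Δ (P.conj s f) S S := by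
    rw [hv]
    exact hloc.step_mul (step_of_mem_center (hker hzker) hloc.S_mem_delta)
      (hloc.step_self hloc.S_mem_delta ht')
  let _ := (hloc.isSubgroup_normalizer hloc.S_mem_delta).group hP
  let _ := hS.group hP
  let v : P.normalizer S := ⟨P.conj s f, hvS.2.2⟩
  let s₀ : S := ⟨s, hsS⟩
  have hpow : ∀ i : ℕ, Step P Δ (s₀ ^ i).1 Q Q ∧ (v ^ i).1 = P.conj (s₀ ^ i).1 f := by
    intro i
    induction i with
    | zero =>
      exact ⟨hloc.step_self hf.1 (hloc.delta_subgroups _ hf.1).1.one_mem, (hP.one_conj f).symm⟩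
    | succ i ih =>
      rw [pow_succ, pow_succ]
      refine ⟨hloc.step_mul ih.1 hsQ, ?_⟩
      change P.pi [(v ^ i).1, P.conj s f] = P.conj (P.pi [(s₀ ^ i).1, s]) f
      rw [ih.2]
      refine hP.conj_mul (hloc.mem_D (Q := R) (R := R) ?_)
      exact .cons (hf.inv hP) (.cons ih.1 (.cons hf hp0))
  obtain ⟨n, hn⟩ := hloc.isPGroup_S s₀
  refine hloc.mem_S_of_pow_eq_one v n (Subtype.ext ?_)
  rw [(hpow _).2, hn]
  exact hP.one_conj f

/-- The left stabilizer of the image of `f` is an object conjugated by `f` to an object. -/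
theorem exists_step_leftStabilizer [Fact p.Prime] (hloc : IsLocality p P Δ S)
    (hP' : IsPartialGroup P') (hβ : IsHom P P' β) (hker : pgKer P P' β ⊆ P.center) (f : L) :
    ∃ R, Step P Δ f (leftStabilizer P' β S (β f)) R := by
  have hP := hloc.isPartialGroup
  have hS := hloc.isSubgroup_S
  have : Finite L := hloc.finite
  have hB := hloc.isSubgroup_leftStabilizer hP' hβ f
  obtain ⟨Q, hQmax⟩ := (Set.toFinite {Q | ∃ R, Step P Δ f Q R}).exists_maximal
    (hloc.exists_step f)
  obtain ⟨R, hf⟩ := hQmax.prop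
  have hQ := (hloc.delta_subgroups Q hf.1).1
  have hQB : Q ⊆ leftStabilizer P' β S (β f) := hloc.subset_leftStabilizer hβ hf
  let _ := hS.group hP
  let B₀ : Subgroup S := hS.toSubgroup hP hB
  let Q₀ : Subgroup S := hS.toSubgroup hP hQ
  let N₀ : Subgroup S := B₀ ⊓ Subgroup.normalizer (Q₀ : Set S)
  let N : Set L := Subtype.val '' (N₀ : Set S)
  have hN : P.IsSubgroup N := hS.image_val hP N₀
  have hNS : N ⊆ S := by
    rintro _ ⟨x, -, rfl⟩
    exact x.2
  have hQN : Q ⊆ N := fun q hq =>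
    ⟨⟨q, (hloc.delta_subgroups Q hf.1).2 hq⟩, ⟨hQB hq, Subgroup.le_normalizer hq⟩, rfl⟩
  have hNQ : ∀ s ∈ N, Step P Δ s Q Q := by
    have hsub : ∀ s ∈ N, P.conjSet Q s ⊆ Q := by
      rintro _ ⟨s, hs, rfl⟩ _ ⟨q, hq, rfl⟩
      let q₀ : S := ⟨q, (hloc.delta_subgroups Q hf.1).2 hq⟩
      have h1 : s⁻¹ * q₀ * s⁻¹⁻¹ ∈ Q₀ :=
        (Subgroup.mem_normalizer_iff.1 (Subgroup.inv_mem _ hs.2) q₀).1 hq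
      rw [inv_inv] at h1
      have hD : [P.inv s, q, s] ∈ P.D := hS.subset_Dconj (hloc.delta_subgroups Q hf.1).2 s.2 hq
      have e : P.conj q s = (s⁻¹ * q₀ * s).1 := hP.assoc_pi [] [P.inv s, q] [s] hD
      change P.conj q s ∈ Q
      rw [e]
      exact h1
    intro s hs
    have h1 := hloc.step_of_mem_S (hNS hs) hf.1
    have e : P.conjSet Q s = Q := by
      refine (hsub s hs).antisymm ?_
      have hi := hN.1.1 s hs
      have h2 := ((hloc.step_of_mem_S (hNS hi) hf.1).inv hP).2.2.2
      rw [hP.inv_inv] at h2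
      conv_lhs => rw [← h2]
      exact Set.image_mono (hsub _ hi)
    rwa [e] at h1
  have hND : ∀ a ∈ N, ∀ b ∈ N, [P.inv f, a, f, P.inv f, b, f] ∈ P.D := fun a ha b hb =>
    hloc.mem_D (.cons (hf.inv hP) (.cons (hNQ a ha) (.cons hf (.cons (hf.inv hP)
      (.cons (hNQ b hb) hf.singleton)))))
  have hNf : P.conjSet N f ⊆ S := by
    rintro _ ⟨s, hs, rfl⟩
    refine hloc.conj_mem_S_of_mem_leftStabilizer hP' hβ hker hf ?_ (hNQ s hs)
    obtain ⟨s₀, hs₀, rfl⟩ := hs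
    exact hs₀.1
  have hstep : Step P Δ f N (P.conjSet N f) := by
    refine ⟨hloc.mem_delta_of_superset hf.1 hN hNS hQN, ?_,
      fun a ha => hP.append_left [P.inv f, a, f] _ (hND a ha a ha), rfl⟩
    refine hloc.mem_delta_of_superset hf.2.1 (hS.conjSet hP hN hND hNf) hNf ?_
    rw [← hf.2.2.2]
    exact Set.image_mono hQN
  have hNleQ : N ⊆ Q := hQmax.le_of_ge ⟨_, hstep⟩ hQN
  have hBQ : B₀ ≤ Q₀ :=
    hloc.isPGroup_S.le_of_inf_normalizer_le (fun x hx => hQB hx) fun x hx => hNleQ ⟨x, hx, rfl⟩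
  have e : leftStabilizer P' β S (β f) = Q :=
    Set.Subset.antisymm (fun x hx => hBQ (x := ⟨x, hx.1⟩) hx) hQB
  exact ⟨R, e ▸ hf⟩

/-- Elements with the same image under `β` conjugate objects in the same way. -/
theorem step_of_map_eq [Fact p.Prime] (hloc : IsLocality p P Δ S) (hP' : IsPartialGroup P')
    (hβ : IsHom P P' β) (hker : pgKer P P' β ⊆ P.center) {f h : L} (hfh : β f = β h)
    {X Y : Set L} (hf : Step P Δ f X Y) : Step P Δ h X Y := by
  have hP := hloc.isPartialGroup
  have : Nonempty L := ⟨f⟩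
  obtain ⟨R, hR⟩ := hloc.exists_step_leftStabilizer hP' hβ hker f
  obtain ⟨T, hT⟩ := hloc.exists_step_leftStabilizer hP' hβ hker h
  rw [← hfh] at hT
  have hD : [f, P.inv f, h] ∈ P.D := hloc.mem_D (.cons hR (.cons (hR.inv hP) hT.singleton))
  have hD1 : [P.inv f, h] ∈ P.D := hP.append_right [f] _ hD
  have hz : P.pi [P.inv f, h] ∈ pgKer P P' β := by
    have e : P'.pi [β (P.inv f), β h] = β (P.pi [P.inv f, h]) := hβ.2 _ hD1
    rw [hβ.map_inv hP hP', hfh, hP'.inv_mul] at e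
    exact e.symm
  have e : P.pi [f, P.pi [P.inv f, h]] = h := by
    have e1 := hP.assoc_pi [] [f, P.inv f] [h] hD
    have e2 := hP.assoc_pi [f] [P.inv f, h] [] hD
    simp only [List.nil_append, List.cons_append, List.append_nil, hP.mul_inv,
      hP.one_mul] at e1 e2
    exact e2.symm.trans e1
  rw [← e]
  exact hloc.step_mul hf (step_of_mem_center (hker hz) hf.2.1)

/-- Membership in the domain only depends on the image under `β`. -/
theorem mem_D_of_map_eq [Fact p.Prime] (hloc : IsLocality p P Δ S) (hP' : IsPartialGroup P')
    (hβ : IsHom P P' β) (hker : pgKer P P' β ⊆ P.center) {u w : List L} (hw : w ∈ P.D)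
    (huw : w.map β = u.map β) : u ∈ P.D := by
  obtain ⟨Q, R, h⟩ := hloc.mem_D_iff.1 hw
  suffices hu : Path P Δ u Q R from hloc.mem_D hu
  clear hw
  induction h generalizing u with
  | nil hQ =>
    obtain rfl : u = [] := by simpa using huw.symm
    exact .nil hQ
  | cons hs _ ih =>
    cases u with
    | nil => simp at huw
    | cons a u =>
      rw [List.map_cons, List.map_cons, List.cons.injEq] at huw
      exact .cons (hloc.step_of_map_eq hP' hβ hker huw.1 hs) (ih huw.2)

end IsLocality

/-- Lemma 3.10: if `(L,Δ,S)` is a locality, `L'` a partial group, `β : L → L'` a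
projection of partial groups with `ker(β) ⊆ Z(L)`, and `H` a partial subgroup of
`L`, then `Hβ` is a partial subgroup of `L'` and `(D ∩ W(H))β* = D' ∩ W(Hβ)`; in
particular `β|_H : H → Hβ` is a projection of partial groups. -/
theorem partialSubgroup_image_modCentral (p : ℕ) (hp : p.Prime) (P : Data L)
    (Δ : Set (Set L)) (S : Set L) (hloc : IsLocality p P Δ S) (P' : Data L')
    (hP' : IsPartialGroup P') (β : L → L') (hβ : IsProjection P P' β)
    (hker : pgKer P P' β ⊆ P.center) (H : Set L) (hH : P.IsPartialSubgroup H) :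
    P'.IsPartialSubgroup (β '' H) ∧
    List.map β '' (P.D ∩ Wrd H) = P'.D ∩ Wrd (β '' H) ∧
    IsProjBetween P P' H (β '' H) β := by
  have hp' : Fact p.Prime := ⟨hp⟩
  have hP := hloc.isPartialGroup
  have : Nonempty L := ⟨P.one⟩
  have hlift : ∀ w' ∈ P'.D ∩ Wrd (β '' H), ∃ w ∈ P.D ∩ Wrd H, w.map β = w' := by
    rintro w' ⟨hD', hW⟩
    obtain ⟨w, hw, rfl⟩ := hβ.2 w' hD'
    have hu : ∀ v' : List L', v' ∈ Wrd (β '' H) → ∃ u ∈ Wrd H, u.map β = v' := by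
      intro v'
      induction v' with
      | nil => exact fun _ => ⟨[], by simp [Wrd], rfl⟩
      | cons a v' ih =>
        intro hv
        obtain ⟨x, hx, rfl⟩ := hv a List.mem_cons_self
        obtain ⟨u, hu, rfl⟩ := ih fun y hy => hv y (List.mem_cons_of_mem _ hy)
        exact ⟨x :: u, List.forall_mem_cons.2 ⟨hx, hu⟩, rfl⟩
    obtain ⟨u, huH, hu⟩ := hu _ hW
    exact ⟨u, ⟨hloc.mem_D_of_map_eq hP' hβ.1 hker hw hu.symm, huH⟩, hu⟩
  refine ⟨⟨?_, ?_⟩, ?_, rfl, ⟨fun w hw => hβ.1.1 w hw.1, fun w hw => hβ.1.2 w hw.1⟩, hlift⟩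
  · rintro _ ⟨h, hh, rfl⟩
    exact ⟨P.inv h, hH.1 h hh, hβ.1.map_inv hP hP' h⟩
  · rintro w' ⟨hW, hD'⟩
    obtain ⟨w, hw, rfl⟩ := hlift w' ⟨hD', hW⟩
    rw [hβ.1.2 w hw.1]
    exact ⟨_, hH.2 w hw.symm, rfl⟩
  · refine Set.Subset.antisymm ?_ hlift
    rintro _ ⟨w, hw, rfl⟩
    refine ⟨hβ.1.1 w hw.1, fun y hy => ?_⟩
    obtain ⟨x, hx, rfl⟩ := List.mem_map.1 hy
    exact ⟨x, hw.2 x hx, rfl⟩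

end PartialGroups
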